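/- Let φ : U \ D → ℝ be continuous with log-log growth along a normal crossing divisor D in a polydisc U, and suppose the current T = ∂∂̄[φ]/(2πi) on U \ D has log-log growth along D. Then ∂∂̄[φ]_{L¹}/(2πi) = [T]_{L¹} as currents on U; i.e., the trivial L¹-extension of the potential computes the trivial L¹-extension of the curvature, with no residual current supported on D. -/

import Mathlib

open MeasureTheory ComplexOrder

/-- The Wirtinger derivative `∂/∂z_i` of `f : ℂ^q → ℂ`. -/
noncomputable def wirtD (q : ℕ) (i : Fin q) (f : (Fin q → ℂ) → ℂ) (z : Fin q → ℂ) : ℂ :=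
  (1 / 2) * (fderiv ℝ f z (Pi.single i 1) - Complex.I * fderiv ℝ f z (Pi.single i Complex.I))

/-- The Wirtinger derivative `∂/∂z̄_i` of `f : ℂ^q → ℂ`. -/
noncomputable def wirtDbar (q : ℕ) (i : Fin q) (f : (Fin q → ℂ) → ℂ) (z : Fin q → ℂ) : ℂ :=
  (1 / 2) * (fderiv ℝ f z (Pi.single i 1) + Complex.I * fderiv ℝ f z (Pi.single i Complex.I))

/-- The unit polydisc in `ℂ^q`. -/
def polyDisc (q : ℕ) : Set (Fin q → ℂ) := {z | ∀ i, ‖z i‖ < 1}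

/-- The normal crossing divisor `∪_{i<l} {z_i = 0}`. -/
def ncDivisor (q l : ℕ) : Set (Fin q → ℂ) := {z | ∃ i : Fin q, (i : ℕ) < l ∧ z i = 0}

/-- `max_{i<l} |z_i|`. -/
noncomputable def maxCoordNorm (q l : ℕ) (z : Fin q → ℂ) : ℝ :=
  ⨆ i : Fin q, if (i : ℕ) < l then ‖z i‖ else 0

/-- The log-log factor `ln|ln(max_{i<l}|z_i|)|`. -/
noncomputable def logLogFactor (q l : ℕ) (z : Fin q → ℂ) : ℝ :=
  Real.log |Real.log (maxCoordNorm q l z)|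

/-- The Poincaré weight attached to the coordinate `z_i`: `1/(|z_i|·|ln|z_i||)` for a
divisor coordinate `i < l`, and `1` otherwise; these are the sizes of the frame
`dζ_i` used to define forms of log-log growth. -/
noncomputable def poincWeight (q l : ℕ) (i : Fin q) (z : Fin q → ℂ) : ℝ :=
  if (i : ℕ) < l then 1 / (‖z i‖ * |Real.log ‖z i‖|) else 1

/-- A test function for currents on `s`: smooth, compactly supported inside `s`. -/
def IsTestFn (q : ℕ) (η : (Fin q → ℂ) → ℂ) (s : Set (Fin q → ℂ)) : Prop :=
  ContDiff ℝ (⊤ : ℕ∞) η ∧ HasCompactSupport η ∧ tsupport η ⊆ s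

/-- A `(1,1)`-current given by a locally integrable matrix of coefficients
`T = Σ T_{ij} i dz_i ∧ dz̄_j` is closed on `s`: distributionally, `∂_k T_{ij} = ∂_i T_{kj}`
and `∂̄_k T_{ij} = ∂̄_j T_{ik}`. -/
def ClosedCurrentOn (q : ℕ) (T : (Fin q → ℂ) → Matrix (Fin q) (Fin q) ℂ)
    (s : Set (Fin q → ℂ)) : Prop :=
  ∀ η : (Fin q → ℂ) → ℂ, IsTestFn q η s → ∀ i j k : Fin q,
    (∫ z in s, T z i j * wirtD q k η z) = (∫ z in s, T z k j * wirtD q i η z) ∧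
    (∫ z in s, T z i j * wirtDbar q k η z) = (∫ z in s, T z i k * wirtDbar q j η z)

/-- A `(1,1)`-current with matrix of coefficients `T` is positive on `s` if its
coefficient matrix is positive semidefinite a.e. on `s`. -/
def AEPosCurrentOn (q : ℕ) (T : (Fin q → ℂ) → Matrix (Fin q) (Fin q) ℂ)
    (s : Set (Fin q → ℂ)) : Prop :=
  ∀ᵐ (z : Fin q → ℂ) ∂volume, z ∈ s → (T z).PosSemidef

/-- A `(1,1)`-current on `s` has log-log growth along the divisor `∪_{i<l}{z_i=0}` if its
coefficients are bounded by Poincaré-frame monomials with log-log coefficients. -/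
def MatLogLogGrowth (q l : ℕ) (T : (Fin q → ℂ) → Matrix (Fin q) (Fin q) ℂ)
    (s : Set (Fin q → ℂ)) : Prop :=
  ∃ C > 0, ∃ p : ℕ, ∀ᵐ (z : Fin q → ℂ) ∂volume, z ∈ s \ ncDivisor q l →
    ∀ i j, ‖T z i j‖ ≤
      C * poincWeight q l i z * poincWeight q l j z * ((logLogFactor q l z) ^ p + 1)

/-- The complex Hessian `(∂_i ∂̄_j f)_{ij}` of a real function on `ℂ^q`. -/
noncomputable def hessMat (q : ℕ) (f : (Fin q → ℂ) → ℝ) (z : Fin q → ℂ) :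
    Matrix (Fin q) (Fin q) ℂ :=
  fun i j => wirtD q i (wirtDbar q j (fun y => (f y : ℂ))) z

/-- `a_p(z,w) = -(ln|ln|z|²|)^p (ln|ln|w|²|)^p`. -/
noncomputable def apFun (p : ℕ) (z w : ℂ) : ℝ :=
  -((Real.log |Real.log (‖z‖ ^ 2)|) ^ p * (Real.log |Real.log (‖w‖ ^ 2)|) ^ p)

/-- `a_p⁰(z,w) = (ln|ln|z|²|)^p |w|²`. -/
noncomputable def ap0Fun (p : ℕ) (z w : ℂ) : ℝ :=
  (Real.log |Real.log (‖z‖ ^ 2)|) ^ p * ‖w‖ ^ 2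

/-- The comparison potential
`A_p = (q+1)·Σ_{i,j<l} a_p(z_i,z_j) + Σ_{i<l, j≥l} a_p⁰(z_i,z_j)`. -/
noncomputable def bigA (q l p : ℕ) (z : Fin q → ℂ) : ℝ :=
  ((q : ℝ) + 1) *
      (∑ i : Fin q, ∑ j : Fin q,
        if (i : ℕ) < l ∧ (j : ℕ) < l then apFun p (z i) (z j) else 0) +
    ∑ i : Fin q, ∑ j : Fin q,
      if (i : ℕ) < l ∧ l ≤ (j : ℕ) then ap0Fun p (z i) (z j) else 0

/-- The operator `(∂_x + s ∂_y)/2` in the coordinate `z_i = x + iy`; `s = -i` gives `∂/∂z_i` and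
`s = i` gives `∂/∂z̄_i`. -/
noncomputable def wirt (q : ℕ) (s : ℂ) (i : Fin q) (f : (Fin q → ℂ) → ℂ) (z : Fin q → ℂ) : ℂ :=
  (1 / 2) * (fderiv ℝ f z (Pi.single i 1) + s * fderiv ℝ f z (Pi.single i Complex.I))

lemma wirtD_eq_wirt (q : ℕ) (i : Fin q) : wirtD q i = wirt q (-Complex.I) i := by
  funext f z
  simp only [wirtD, wirt]
  ring

lemma wirtDbar_eq_wirt (q : ℕ) (i : Fin q) : wirtDbar q i = wirt q Complex.I i := rfl

section Wirt

variable {q : ℕ} {s : ℂ} {i : Fin q} {f g : (Fin q → ℂ) → ℂ} {z : Fin q → ℂ}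

lemma wirt_mul (hf : DifferentiableAt ℝ f z) (hg : DifferentiableAt ℝ g z) :
    wirt q s i (fun y => f y * g y) z = f z * wirt q s i g z + wirt q s i f z * g z := by
  simp only [wirt, fderiv_fun_mul hf hg]
  simp
  ring

lemma wirt_add (hf : DifferentiableAt ℝ f z) (hg : DifferentiableAt ℝ g z) :
    wirt q s i (fun y => f y + g y) z = wirt q s i f z + wirt q s i g z := by
  simp only [wirt, fderiv_fun_add hf hg]
  simp
  ring

lemma ContDiff.wirt (hf : ContDiff ℝ (⊤ : ℕ∞) f) : ContDiff ℝ (⊤ : ℕ∞) (wirt q s i f) := by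
  have h : ContDiff ℝ (⊤ : ℕ∞) (fderiv ℝ f) := hf.fderiv_right (by simp)
  unfold _root_.wirt
  fun_prop

lemma Filter.EventuallyEq.wirt (h : f =ᶠ[nhds z] g) :
    _root_.wirt q s i f =ᶠ[nhds z] _root_.wirt q s i g := by
  filter_upwards [h.fderiv (𝕜 := ℝ)] with y hy
  simp [_root_.wirt, hy]

lemma wirt_const (c : ℂ) : wirt q s i (fun _ => c) = fun _ => 0 := by
  funext z
  simp [wirt]

lemma wirt_comp_apply {m : Fin q} {h : ℂ → ℂ} {h' : ℂ →L[ℝ] ℂ} (hh : HasFDerivAt h h' (z m)) :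
    wirt q s i (fun y => h (y m)) z = if i = m then (1 / 2) * (h' 1 + s * h' Complex.I) else 0 := by
  have h1 : HasFDerivAt (fun y : Fin q → ℂ => h (y m))
      (h'.comp (ContinuousLinearMap.proj (R := ℝ) (φ := fun _ : Fin q => ℂ) m)) z :=
    HasFDerivAt.comp z hh (hasFDerivAt_apply m z)
  unfold wirt
  rw [h1.fderiv]
  split_ifs with him
  · subst him
    simp
  · simp [Pi.single_eq_of_ne (Ne.symm him)]

/-- Second order product rule. -/
lemma wirtD_wirtDbar_mul {j : Fin q} (hf : ContDiff ℝ (⊤ : ℕ∞) f) (hg : ContDiff ℝ (⊤ : ℕ∞) g) :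
    wirtD q i (wirtDbar q j (fun y => f y * g y)) z =
      f z * wirtD q i (wirtDbar q j g) z + wirtD q i f z * wirtDbar q j g z +
      (wirtDbar q j f z * wirtD q i g z + wirtD q i (wirtDbar q j f) z * g z) := by
  have hd : ∀ {F : (Fin q → ℂ) → ℂ}, ContDiff ℝ (⊤ : ℕ∞) F → ∀ y, DifferentiableAt ℝ F y :=
    fun hF y => hF.differentiable (by simp) y
  rw [wirtD_eq_wirt, wirtDbar_eq_wirt]
  have h1 : wirt q Complex.I j (fun y => f y * g y) =
      fun y => f y * wirt q Complex.I j g y + wirt q Complex.I j f y * g y := by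
    funext y
    exact wirt_mul (hd hf y) (hd hg y)
  rw [h1, wirt_add (hd (hf.mul hg.wirt) z) (hd (hf.wirt.mul hg) z),
    wirt_mul (hd hf z) (hd hg.wirt z), wirt_mul (hd hf.wirt z) (hd hg z)]

end Wirt

section CutOff

/-- A smooth function on `ℝ` equal to `1` on `(-∞, 1]` and to `0` on `[2, ∞)`. -/
noncomputable def smoothDrop (t : ℝ) : ℝ := Real.smoothTransition (2 - t)

lemma contDiff_smoothDrop : ContDiff ℝ (⊤ : ℕ∞) smoothDrop :=
  Real.smoothTransition.contDiff.comp (contDiff_const.sub contDiff_id)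

lemma smoothDrop_of_le {t : ℝ} (ht : t ≤ 1) : smoothDrop t = 1 :=
  Real.smoothTransition.one_of_one_le (by linarith)

lemma smoothDrop_of_ge {t : ℝ} (ht : 2 ≤ t) : smoothDrop t = 0 :=
  Real.smoothTransition.zero_of_nonpos (by linarith)

lemma abs_smoothDrop_le (t : ℝ) : |smoothDrop t| ≤ 1 :=
  abs_le.2 ⟨by linarith [Real.smoothTransition.nonneg (2 - t), show smoothDrop t =
    Real.smoothTransition (2 - t) from rfl], Real.smoothTransition.le_one _⟩

/-- A continuous function vanishing off `[1, 2]` is bounded. -/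
lemma exists_bound_of_vanishing {f : ℝ → ℝ} (hf : Continuous f) (h1 : ∀ t < 1, f t = 0)
    (h2 : ∀ t, 2 < t → f t = 0) : ∃ C, 0 ≤ C ∧ ∀ t, |f t| ≤ C := by
  obtain ⟨C, hC⟩ := (isCompact_Icc (a := (1 : ℝ)) (b := 2)).exists_bound_of_continuousOn
    hf.continuousOn
  refine ⟨max C 0, le_max_right _ _, fun t => ?_⟩
  rcases lt_or_ge t 1 with h | h
  · simp [h1 t h]
  rcases lt_or_ge 2 t with h' | h'
  · simp [h2 t h']
  · exact (hC t ⟨h, h'⟩).trans (le_max_left _ _)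

lemma deriv_eq_zero_of_forall_lt {f : ℝ → ℝ} {c a : ℝ} (h : ∀ t < a, f t = c) :
    ∀ t < a, deriv f t = 0 := by
  intro t ht
  have : f =ᶠ[nhds t] fun _ => c := by
    filter_upwards [Iio_mem_nhds ht] with y hy using h y hy
  rw [this.deriv_eq]; simp

lemma deriv_eq_zero_of_forall_gt {f : ℝ → ℝ} {c a : ℝ} (h : ∀ t, a < t → f t = c) :
    ∀ t, a < t → deriv f t = 0 := by
  intro t ht
  have : f =ᶠ[nhds t] fun _ => c := by
    filter_upwards [Ioi_mem_nhds ht] with y hy using h y hy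
  rw [this.deriv_eq]; simp

lemma deriv_smoothDrop_eq_zero :
    (∀ t < 1, deriv smoothDrop t = 0) ∧ (∀ t, 2 < t → deriv smoothDrop t = 0) :=
  ⟨deriv_eq_zero_of_forall_lt fun _ h => smoothDrop_of_le h.le,
    deriv_eq_zero_of_forall_gt fun _ h => smoothDrop_of_ge h.le⟩

lemma deriv_deriv_smoothDrop_eq_zero :
    (∀ t < 1, deriv (deriv smoothDrop) t = 0) ∧ (∀ t, 2 < t → deriv (deriv smoothDrop) t = 0) :=
  ⟨deriv_eq_zero_of_forall_lt deriv_smoothDrop_eq_zero.1,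
    deriv_eq_zero_of_forall_gt deriv_smoothDrop_eq_zero.2⟩

lemma contDiff_deriv_smoothDrop : ContDiff ℝ (⊤ : ℕ∞) (deriv smoothDrop) :=
  ((contDiff_infty_iff_deriv).1 contDiff_smoothDrop).2

/-- The rescaled logarithm `-ln|w|²/n`. -/
noncomputable def scaledLog (n : ℕ) (w : ℂ) : ℝ := -(Real.log (Complex.normSq w)) / n

lemma scaledLog_eq (n : ℕ) (w : ℂ) : scaledLog n w = -(2 * Real.log ‖w‖) / n := by
  rw [scaledLog, Complex.normSq_eq_norm_sq, Real.log_pow]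
  push_cast
  rfl

lemma contDiffAt_scaledLog (n : ℕ) {w : ℂ} (hw : w ≠ 0) : ContDiffAt ℝ (⊤ : ℕ∞) (scaledLog n) w := by
  have h : ContDiffAt ℝ (⊤ : ℕ∞) (fun w : ℂ => ‖w‖ ^ 2) w := (contDiff_norm_sq ℝ).contDiffAt
  have h2 : scaledLog n = fun w : ℂ => -(Real.log (‖w‖ ^ 2)) / n := by
    funext w; rw [scaledLog, Complex.normSq_eq_norm_sq]
  rw [h2]
  exact (h.log (by positivity)).neg.div_const _

lemma fderiv_scaledLog (n : ℕ) {w : ℂ} (hw : w ≠ 0) (c : ℂ) :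
    fderiv ℝ (scaledLog n) w c =
      -(2 * (w.re * c.re + w.im * c.im) / Complex.normSq w) / n := by
  have h : HasFDerivAt (fun w : ℂ => ‖w‖ ^ 2) (2 • innerSL ℝ w) w :=
    (hasStrictFDerivAt_norm_sq w).hasFDerivAt
  have h2 : scaledLog n = fun w : ℂ => -(Real.log (‖w‖ ^ 2)) * (n : ℝ)⁻¹ := by
    funext w; rw [scaledLog, Complex.normSq_eq_norm_sq]; rfl
  have h3 := ((h.log (by positivity)).neg.mul_const (n : ℝ)⁻¹).fderiv
  rw [h2]
  refine (congrArg (fun L : ℂ →L[ℝ] ℝ => L c) h3).trans ?_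
  simp [Complex.normSq_eq_norm_sq, Complex.inner]
  ring

/-- First derivatives of a function of `|z_m|`. -/
lemma wirt_comp_scaledLog {q : ℕ} {s : ℂ} {i m : Fin q} (n : ℕ) {ψ : ℝ → ℝ}
    (hψ : Differentiable ℝ ψ) {z : Fin q → ℂ} (hz : z m ≠ 0) :
    wirt q s i (fun y => (ψ (scaledLog n (y m)) : ℂ)) z =
      if i = m then ((deriv ψ (scaledLog n (z m)) : ℝ) : ℂ) *
        (-((z m).re + s * (z m).im) / (n * Complex.normSq (z m))) else 0 := by
  have h1 : HasFDerivAt (scaledLog n) (fderiv ℝ (scaledLog n) (z m)) (z m) :=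
    ((contDiffAt_scaledLog n hz).differentiableAt (by simp)).hasFDerivAt
  have h2 := (Complex.ofRealCLM.hasFDerivAt).comp (z m)
    ((hψ (scaledLog n (z m))).hasDerivAt.comp_hasFDerivAt (z m) h1)
  refine (wirt_comp_apply (s := s) (i := i) h2).trans ?_
  split_ifs
  · simp [fderiv_scaledLog n hz]
    field_simp
    ring
  · rfl

/-- The antiholomorphic function `1 / z̄_m` is killed by `∂/∂z_i`. -/
lemma wirt_inv_conj {q : ℕ} {i m : Fin q} {z : Fin q → ℂ} (hz : z m ≠ 0) :
    wirt q (-Complex.I) i (fun y => (starRingEnd ℂ (y m))⁻¹) z = 0 := by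
  have h1 : HasFDerivAt (fun w : ℂ => (starRingEnd ℂ w)⁻¹)
      (((ContinuousLinearMap.toSpanSingleton ℂ (-((starRingEnd ℂ (z m)) ^ 2)⁻¹)).restrictScalars
        ℝ).comp (Complex.conjCLE : ℂ →L[ℝ] ℂ)) (z m) := by
    have h2 := (hasDerivAt_inv (x := starRingEnd ℂ (z m)) (by simpa using hz)).hasFDerivAt
    exact (h2.restrictScalars ℝ).comp (z m) (Complex.conjCLE.hasFDerivAt (x := z m))
  rw [wirt_comp_apply h1]
  split_ifs
  · simp
    linear_combination (-((starRingEnd ℂ (z m)) ^ 2)⁻¹) * Complex.I_sq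
  · rfl

/-- The cut-off function of the divisor `{z_m = 0}`, equal to `1` where `ln|z_m|² ≥ -n` and to `0`
where `ln|z_m|² ≤ -2n`. -/
noncomputable def logCut (q : ℕ) (m : Fin q) (n : ℕ) (z : Fin q → ℂ) : ℂ :=
  if z m = 0 then 0 else (smoothDrop (scaledLog n (z m)) : ℂ)

variable {q : ℕ} {m : Fin q}

lemma logCut_eventuallyEq (n : ℕ) {z : Fin q → ℂ} (hz : z m ≠ 0) :
    logCut q m n =ᶠ[nhds z] fun y => (smoothDrop (scaledLog n (y m)) : ℂ) := by
  have : ∀ᶠ y in nhds z, y m ≠ 0 := (continuous_apply m).continuousAt.eventually_ne hz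
  filter_upwards [this] with y hy
  simp [logCut, hy]

lemma logCut_eventuallyEq_zero {n : ℕ} (hn : 0 < n) {z : Fin q → ℂ} (hz : z m = 0) :
    logCut q m n =ᶠ[nhds z] fun _ => 0 := by
  have h1 : Filter.Tendsto (fun y : Fin q → ℂ => ‖y m‖) (nhds z) (nhds 0) := by
    have : Continuous fun y : Fin q → ℂ => ‖y m‖ := by fun_prop
    simpa [hz] using this.tendsto z
  filter_upwards [h1.eventually (Iio_mem_nhds (Real.exp_pos (-n)))] with y hy
  unfold logCut
  split_ifs with h
  · rfl
  · have h2 : Real.log ‖y m‖ < -n := by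
      rw [← Real.log_exp (-n)]
      exact Real.log_lt_log (by positivity) hy
    have hn' : (0 : ℝ) < n := by exact_mod_cast hn
    rw [smoothDrop_of_ge, Complex.ofReal_zero]
    rw [scaledLog_eq, le_div_iff₀ hn']
    linarith

lemma logCut_eventuallyEq_one {z : Fin q → ℂ} (hz : z m ≠ 0) :
    ∀ᶠ n : ℕ in Filter.atTop, logCut q m n =ᶠ[nhds z] fun _ => 1 := by
  obtain ⟨N, hN⟩ := exists_nat_gt (-(2 * Real.log ‖z m‖))
  filter_upwards [Filter.eventually_ge_atTop (max N 1)] with n hn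
  have h1 : ContinuousAt (fun y : Fin q → ℂ => scaledLog n (y m)) z :=
    ((contDiffAt_scaledLog n hz).continuousAt).comp (f := fun y : Fin q → ℂ => y m)
      (continuous_apply m).continuousAt
  have hn' : (0 : ℝ) < n := by exact_mod_cast (le_max_right N 1).trans hn
  have hNn : (N : ℝ) ≤ n := by exact_mod_cast (le_max_left N 1).trans hn
  have h2 : scaledLog n (z m) < 1 := by
    rw [scaledLog_eq, div_lt_one hn']
    linarith
  filter_upwards [h1.eventually_lt continuousAt_const h2, logCut_eventuallyEq n hz] with y hy hy2
  rw [hy2, smoothDrop_of_le hy.le, Complex.ofReal_one]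

lemma contDiff_logCut {n : ℕ} (hn : 0 < n) : ContDiff ℝ (⊤ : ℕ∞) (logCut q m n) := by
  rw [contDiff_iff_contDiffAt]
  intro z
  by_cases hz : z m = 0
  · exact contDiffAt_const.congr_of_eventuallyEq (logCut_eventuallyEq_zero hn hz)
  · refine ContDiffAt.congr_of_eventuallyEq ?_ (logCut_eventuallyEq n hz)
    have h1 : ContDiffAt ℝ (⊤ : ℕ∞) (fun y : Fin q → ℂ => scaledLog n (y m)) z :=
      (contDiffAt_scaledLog n hz).comp (f := fun y : Fin q → ℂ => y m) z
        (contDiff_apply ℝ ℂ m).contDiffAt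
    exact Complex.ofRealCLM.contDiff.contDiffAt.comp z
      (contDiff_smoothDrop.contDiffAt.comp z h1)

lemma norm_logCut_le (n : ℕ) (z : Fin q → ℂ) : ‖logCut q m n z‖ ≤ 1 := by
  unfold logCut
  split_ifs
  · simp
  · simpa using abs_smoothDrop_le _

lemma wirtD_logCut (n : ℕ) {i : Fin q} {z : Fin q → ℂ} (hz : z m ≠ 0) :
    wirtD q i (logCut q m n) z = if i = m then
      ((deriv smoothDrop (scaledLog n (z m)) : ℝ) : ℂ) * (-(n * z m)⁻¹) else 0 := by
  rw [wirtD_eq_wirt, (logCut_eventuallyEq n hz).wirt.eq_of_nhds,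
    wirt_comp_scaledLog n (contDiff_smoothDrop.differentiable (by simp)) hz]
  have h : ((z m).re + -Complex.I * (z m).im : ℂ) = starRingEnd ℂ (z m) := by
    apply Complex.ext <;> simp
  have hc : starRingEnd ℂ (z m) ≠ 0 := by simpa using hz
  rw [h, Complex.normSq_eq_conj_mul_self]
  congr 2
  field_simp

lemma wirtDbar_logCut (n : ℕ) {j : Fin q} {z : Fin q → ℂ} (hz : z m ≠ 0) :
    wirtDbar q j (logCut q m n) z = if j = m then
      ((deriv smoothDrop (scaledLog n (z m)) : ℝ) : ℂ) * (-(n : ℂ)⁻¹ * (starRingEnd ℂ (z m))⁻¹) else 0 := by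
  rw [wirtDbar_eq_wirt, (logCut_eventuallyEq n hz).wirt.eq_of_nhds,
    wirt_comp_scaledLog n (contDiff_smoothDrop.differentiable (by simp)) hz]
  have h : ((z m).re + Complex.I * (z m).im : ℂ) = z m := by
    apply Complex.ext <;> simp
  have hc : starRingEnd ℂ (z m) ≠ 0 := by simpa using hz
  rw [h, Complex.normSq_eq_conj_mul_self]
  congr 2
  field_simp

lemma wirtD_wirtDbar_logCut (n : ℕ) {i j : Fin q} {z : Fin q → ℂ} (hz : z m ≠ 0) :
    wirtD q i (wirtDbar q j (logCut q m n)) z = if i = m ∧ j = m then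
      ((deriv (deriv smoothDrop) (scaledLog n (z m)) : ℝ) : ℂ) *
        ((n * z m)⁻¹ * (n * starRingEnd ℂ (z m))⁻¹) else 0 := by
  have hne : ∀ᶠ y in nhds z, y m ≠ 0 := (continuous_apply m).continuousAt.eventually_ne hz
  have hc : starRingEnd ℂ (z m) ≠ 0 := by simpa using hz
  rw [wirtD_eq_wirt]
  by_cases hj : j = m
  · have h1 : wirtDbar q j (logCut q m n) =ᶠ[nhds z] fun y =>
        ((deriv smoothDrop (scaledLog n (y m)) : ℝ) : ℂ) *
          (-(n : ℂ)⁻¹ * (starRingEnd ℂ (y m))⁻¹) := by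
      filter_upwards [hne] with y hy
      rw [wirtDbar_logCut n hy, if_pos hj]
    have hd1 : DifferentiableAt ℝ (fun y : Fin q → ℂ =>
        ((deriv smoothDrop (scaledLog n (y m)) : ℝ) : ℂ)) z := by
      have h2 : DifferentiableAt ℝ (fun y : Fin q → ℂ => scaledLog n (y m)) z :=
        ((contDiffAt_scaledLog n hz).differentiableAt (by simp)).comp
          (f := fun y : Fin q → ℂ => y m) z (differentiableAt_apply m z)
      exact Complex.ofRealCLM.differentiableAt.comp z
        ((contDiff_deriv_smoothDrop.differentiable (by simp) _).comp z h2)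
    have hd2 : DifferentiableAt ℝ (fun y : Fin q → ℂ => (starRingEnd ℂ (y m))⁻¹) z := by
      have h3 : DifferentiableAt ℝ (fun y : Fin q → ℂ => starRingEnd ℂ (y m)) z :=
        Complex.conjCLE.differentiableAt.comp z (differentiableAt_apply m z)
      exact h3.inv hc
    have hd3 : DifferentiableAt ℝ (fun _ : Fin q → ℂ => -(n : ℂ)⁻¹) z := differentiableAt_const _
    rw [h1.wirt.eq_of_nhds, wirt_mul hd1 (hd3.fun_mul hd2), wirt_mul hd3 hd2, wirt_inv_conj hz,
      wirt_const, wirt_comp_scaledLog n (contDiff_deriv_smoothDrop.differentiable (by simp)) hz]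
    have h : ((z m).re + -Complex.I * (z m).im : ℂ) = starRingEnd ℂ (z m) := by
      apply Complex.ext <;> simp
    rw [h, Complex.normSq_eq_conj_mul_self]
    by_cases hi : i = m
    · simp only [hi, hj, if_true, and_self]
      rcases Nat.eq_zero_or_pos n with rfl | hn
      · simp
      · have : (n : ℂ) ≠ 0 := by exact_mod_cast hn.ne'
        field_simp
        ring
    · simp [hi]
  · have h1 : wirtDbar q j (logCut q m n) =ᶠ[nhds z] fun _ => 0 := by
      filter_upwards [hne] with y hy
      rw [wirtDbar_logCut n hy, if_neg hj]
    rw [h1.wirt.eq_of_nhds, wirt_const]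
    simp [hj]

end CutOff

section Domination

/-- Powers of the logarithm grow slower than the square root. -/
lemma exists_abs_log_pow_le (p : ℕ) {a : ℝ} (ha : 0 < a) :
    ∃ C, 0 ≤ C ∧ ∀ x, a ≤ x → |Real.log x| ^ p + 1 ≤ C * √x := by
  have h1 : ∀ᶠ x : ℝ in Filter.atTop, |Real.log √x| ^ p ≤ √x := by
    have h := (Real.isLittleO_pow_log_id_atTop (n := p)).bound one_pos
    filter_upwards [Real.tendsto_sqrt_atTop.eventually h] with x hx
    simpa [abs_of_nonneg (Real.sqrt_nonneg x)] using hx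
  obtain ⟨N, hN⟩ := Filter.eventually_atTop.1 h1
  have hcont : ContinuousOn (fun x => |Real.log x| ^ p) (Set.Icc a N) :=
    ((Real.continuousOn_log.mono fun x hx => (ha.trans_le hx.1).ne').abs).pow p
  obtain ⟨B, hB⟩ := isCompact_Icc.exists_bound_of_continuousOn hcont
  have hsa : 0 < √a := Real.sqrt_pos.2 ha
  refine ⟨2 ^ p + |B| / √a + 1 / √a, by positivity, fun x hx => ?_⟩
  have hsx : √a ≤ √x := Real.sqrt_le_sqrt hx
  have e1 : 1 ≤ 1 / √a * √x := by
    rw [one_div, inv_mul_eq_div, le_div_iff₀ hsa]; linarith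
  have e2 : |Real.log x| ^ p ≤ 2 ^ p * √x + |B| / √a * √x := by
    rcases le_total N x with h | h
    · have h2 := hN x h
      have h3 : Real.log x = 2 * Real.log √x := by
        rw [Real.log_sqrt (ha.le.trans hx)]; ring
      have : |Real.log x| ^ p ≤ 2 ^ p * √x := by
        rw [h3, abs_mul, abs_two, mul_pow]
        gcongr
      have : 0 ≤ |B| / √a * √x := by positivity
      linarith
    · have h2 := hB x ⟨hx, h⟩
      rw [Real.norm_of_nonneg (by positivity)] at h2
      have h3 : |B| * 1 ≤ |B| * (1 / √a * √x) := by gcongr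
      have : 0 ≤ 2 ^ p * √x := by positivity
      have : |B| / √a * √x = |B| * (1 / √a * √x) := by ring
      linarith [le_abs_self B]
  linarith [add_mul (2 ^ p + |B| / √a) (1 / √a) √x, add_mul (2 ^ p) (|B| / √a) √x]

/-- The radial profile `√|ln t| / (t ln t)²` on `(0, r]`. -/
noncomputable def radialProfile (r : ℝ) : ℝ → ℝ :=
  (Set.Ioc 0 r).indicator fun t => (1 / (t * |Real.log t|)) ^ 2 * √|Real.log t|

lemma radialProfile_nonneg (r t : ℝ) : 0 ≤ radialProfile r t :=
  Set.indicator_nonneg (fun _ _ => by positivity) _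

lemma integrable_radialProfile_norm {r : ℝ} (hr : r < 1) :
    Integrable (fun w : ℂ => radialProfile r ‖w‖) := by
  rw [integrable_fun_norm_addHaar volume (f := radialProfile r), Complex.finrank_real_complex]
  have hlog : ∀ t ∈ Set.Ioc 0 r, Real.log t < 0 := fun t ht =>
    Real.log_neg ht.1 (ht.2.trans_lt hr)
  have h1 : IntegrableOn (fun t : ℝ => 1 / (t * (-Real.log t) * √(-Real.log t)))
      (Set.Ioc 0 r) := by
    refine intervalIntegral.integrableOn_deriv_of_nonneg
      (g := fun t => 2 / √(-Real.log t)) ?_ ?_ ?_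
    · intro t ht
      rcases ht.1.eq_or_lt with rfl | h0
      · have hlim : Filter.Tendsto (fun t => 2 / √(-Real.log t)) (nhdsWithin 0 (Set.Ioi 0))
            (nhds 0) := by
          refine Filter.Tendsto.div_atTop tendsto_const_nhds (Real.tendsto_sqrt_atTop.comp ?_)
          exact Filter.tendsto_neg_atBot_atTop.comp Real.tendsto_log_nhdsGT_zero
        have : ContinuousWithinAt (fun t => 2 / √(-Real.log t)) (Set.Ioi 0) 0 := by
          simpa [ContinuousWithinAt] using hlim
        rw [← continuousWithinAt_insert_self, Set.Ioi_insert] at this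
        exact this.mono Set.Icc_subset_Ici_self
      · have hl := hlog t ⟨h0, ht.2⟩
        have : √(-Real.log t) ≠ 0 := (Real.sqrt_pos.2 (by linarith)).ne'
        exact ((continuousAt_const.div ((Real.continuousAt_log h0.ne').neg.sqrt) this)
          ).continuousWithinAt
    · intro t ht
      have hl := hlog t ⟨ht.1, ht.2.le⟩
      have hs : 0 < √(-Real.log t) := Real.sqrt_pos.2 (by linarith)
      have hd := ((((Real.hasDerivAt_log ht.1.ne').neg).sqrt (by simpa using hl.ne)).fun_inv hs.ne'
        ).const_mul 2
      have h0 := ht.1.ne'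
      have hsq : √(-Real.log t) ^ 2 = -Real.log t := Real.sq_sqrt (by linarith)
      have hl' : -Real.log t ≠ 0 := by linarith
      refine (show HasDerivAt (fun t => 2 / √(-Real.log t)) _ t from hd).congr_deriv ?_
      simp only [Pi.neg_apply]
      rw [hsq]
      field_simp
    · intro t ht
      have hl := hlog t ⟨ht.1, ht.2.le⟩
      have := ht.1
      have : 0 < -Real.log t := by linarith
      positivity
  have h2 : (fun y : ℝ => y ^ (2 - 1) • radialProfile r y) =
      (Set.Ioc 0 r).indicator (fun t => 1 / (t * (-Real.log t) * √(-Real.log t))) := by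
    funext t
    by_cases ht : t ∈ Set.Ioc 0 r
    · have hl := hlog t ht
      have hs : 0 < √(-Real.log t) := Real.sqrt_pos.2 (by linarith)
      have h0 := ht.1.ne'
      have hl' : -Real.log t ≠ 0 := by linarith
      simp only [radialProfile, Set.indicator_of_mem ht, abs_of_neg hl, smul_eq_mul]
      have hsq : √(-Real.log t) ^ 2 = -Real.log t := Real.sq_sqrt (by linarith)
      have : ∀ L S : ℝ, L ≠ 0 → 0 < S → S ^ 2 = L →
          t ^ (2 - 1) * ((1 / (t * L)) ^ 2 * S) = 1 / (t * L * S) := by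
        intro L S hL hS h
        subst h
        field_simp
        ring
      exact this _ _ hl' hs hsq
    · simp [radialProfile, Set.indicator_of_notMem ht]
  rw [h2]
  exact (h1.integrable_indicator measurableSet_Ioc).integrableOn

variable {q l : ℕ}

lemma poincWeight_of_lt {i : Fin q} (hi : (i : ℕ) < l) (z : Fin q → ℂ) :
    poincWeight q l i z = 1 / (‖z i‖ * |Real.log ‖z i‖|) := if_pos hi

lemma one_le_poincWeight {z : Fin q → ℂ} (hz : z ∈ polyDisc q \ ncDivisor q l) (i : Fin q) :
    1 ≤ poincWeight q l i z := by
  unfold poincWeight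
  split_ifs with hi
  · have h0 : z i ≠ 0 := fun h => hz.2 ⟨i, hi, h⟩
    have h1 : 0 < ‖z i‖ := norm_pos_iff.2 h0
    have h2 := Real.abs_log_mul_self_lt _ h1 (hz.1 i).le
    rw [abs_mul, abs_of_pos h1, mul_comm] at h2
    have h3 : 0 < |Real.log ‖z i‖| := abs_pos.2 (Real.log_neg h1 (hz.1 i)).ne
    rw [one_le_div (by positivity)]
    exact h2.le
  · exact le_rfl

lemma norm_le_maxCoordNorm {k : Fin q} (hk : (k : ℕ) < l) (z : Fin q → ℂ) :
    ‖z k‖ ≤ maxCoordNorm q l z := by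
  have := le_ciSup (f := fun i : Fin q => if (i : ℕ) < l then ‖z i‖ else 0)
    (Set.finite_range _).bddAbove k
  simp only [if_pos hk] at this
  exact this

lemma maxCoordNorm_le [Nonempty (Fin q)] {r : ℝ} (hr : 0 ≤ r) {z : Fin q → ℂ}
    (hz : ∀ k, ‖z k‖ ≤ r) : maxCoordNorm q l z ≤ r := by
  refine ciSup_le fun i => ?_
  split_ifs
  · exact hz i
  · exact hr

/-- On a smaller polydisc the products of two Poincaré weights and a power of the log-log factor
are dominated by an integrable function. -/
lemma exists_integrable_dominating (hl : 1 ≤ l) {r : ℝ} (hr0 : 0 < r) (hr : r < 1)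
    (p : ℕ) : ∃ F : (Fin q → ℂ) → ℝ, Integrable F ∧
      (∀ z, 0 ≤ F z) ∧ ∀ z ∈ polyDisc q \ ncDivisor q l, (∀ k, ‖z k‖ ≤ r) → ∀ i j,
        poincWeight q l i z * poincWeight q l j z * (|logLogFactor q l z| ^ p + 1) ≤ F z := by
  have hlogr : 0 < |Real.log r| := abs_pos.2 (Real.log_neg hr0 hr).ne
  obtain ⟨C, hC0, hC⟩ := exists_abs_log_pow_le p hlogr
  let G : Fin q → (Fin q → ℂ) → ℝ := fun k z =>
    ∏ m, (if m = k then fun w : ℂ => radialProfile r ‖w‖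
      else (Metric.closedBall (0 : ℂ) r).indicator fun _ => 1) (z m)
  have hG0 : ∀ k z, 0 ≤ G k z := by
    intro k z
    refine Finset.prod_nonneg fun m _ => ?_
    split_ifs
    · exact radialProfile_nonneg _ _
    · exact Set.indicator_nonneg (fun _ _ => zero_le_one) _
  have hGint : ∀ k, Integrable (G k) := by
    intro k
    refine Integrable.fintype_prod (μ := fun _ => volume) fun m => ?_
    split_ifs
    · exact integrable_radialProfile_norm hr
    · refine (integrable_indicator_iff Metric.isClosed_closedBall.measurableSet).2 ?_
      exact integrableOn_const (isCompact_closedBall (0 : ℂ) r).measure_lt_top.ne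
  refine ⟨fun z => C * ∑ k, G k z, (integrable_finsetSum _ fun k _ => hGint k).const_mul C,
    fun z => mul_nonneg hC0 (Finset.sum_nonneg fun k _ => hG0 k z), fun z hz hzr i j => ?_⟩
  have hw := one_le_poincWeight hz
  have hsingle : ∀ a : Fin q, ∃ k : Fin q, (k : ℕ) < l ∧
      poincWeight q l a z ≤ poincWeight q l k z := by
    intro a
    by_cases ha : (a : ℕ) < l
    · exact ⟨a, ha, le_rfl⟩
    · refine ⟨⟨0, by omega⟩, hl, ?_⟩
      rw [show poincWeight q l a z = 1 from if_neg ha]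
      exact hw _
  obtain ⟨k, hk, hkw⟩ : ∃ k : Fin q, (k : ℕ) < l ∧
      poincWeight q l i z * poincWeight q l j z ≤ poincWeight q l k z ^ 2 := by
    rcases le_total (poincWeight q l i z) (poincWeight q l j z) with h | h
    · obtain ⟨k, hk, hkw⟩ := hsingle j
      refine ⟨k, hk, ?_⟩
      rw [sq]
      exact mul_le_mul (h.trans hkw) hkw (zero_le_one.trans (hw j)) (zero_le_one.trans (hw k))
    · obtain ⟨k, hk, hkw⟩ := hsingle i
      refine ⟨k, hk, ?_⟩
      rw [sq]
      exact mul_le_mul hkw (h.trans hkw) (zero_le_one.trans (hw j)) (zero_le_one.trans (hw k))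
  have hzk : 0 < ‖z k‖ := norm_pos_iff.2 fun h => hz.2 ⟨k, hk, h⟩
  have hGk : G k z = poincWeight q l k z ^ 2 * √|Real.log ‖z k‖| := by
    have : ∀ m, (if m = k then fun w : ℂ => radialProfile r ‖w‖
        else (Metric.closedBall (0 : ℂ) r).indicator fun _ => 1) (z m) =
        if m = k then radialProfile r ‖z k‖ else 1 := by
      intro m
      split_ifs with h
      · rw [h]
      · exact Set.indicator_of_mem (by simpa using hzr m) _
    simp only [G, this]
    rw [Finset.prod_ite_eq' Finset.univ k (fun _ => radialProfile r ‖z k‖),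
      if_pos (Finset.mem_univ k), radialProfile, Set.indicator_of_mem (Set.mem_Ioc.2 ⟨hzk, hzr k⟩),
      poincWeight_of_lt hk]
  have : Nonempty (Fin q) := ⟨k⟩
  have hM1 := norm_le_maxCoordNorm hk z
  have hM2 := maxCoordNorm_le (l := l) hr0.le hzr
  have hM0 := hzk.trans_le hM1
  have hlM := Real.log_neg hM0 (hM2.trans_lt hr)
  have hLr : |Real.log r| ≤ |Real.log (maxCoordNorm q l z)| := by
    rw [abs_of_neg hlM, abs_of_neg (Real.log_neg hr0 hr)]
    exact neg_le_neg (Real.log_le_log hM0 hM2)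
  have hLk : |Real.log (maxCoordNorm q l z)| ≤ |Real.log ‖z k‖| := by
    rw [abs_of_neg hlM, abs_of_neg (Real.log_neg hzk (hz.1 k))]
    exact neg_le_neg (Real.log_le_log hzk hM1)
  calc poincWeight q l i z * poincWeight q l j z * (|logLogFactor q l z| ^ p + 1)
      ≤ poincWeight q l k z ^ 2 * (C * √|Real.log ‖z k‖|) := by
        gcongr
        exact (hC _ hLr).trans (by gcongr)
    _ = C * G k z := by rw [hGk]; ring
    _ ≤ C * ∑ k, G k z := by
        gcongr
        exact Finset.single_le_sum (f := fun k => G k z) (fun k _ => hG0 k z) (Finset.mem_univ k)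

/-- The derivatives of the logarithmic cut-off functions are controlled by the Poincaré weights. -/
lemma exists_logCut_bound (q l : ℕ) (m : Fin q) (hm : (m : ℕ) < l) :
    ∃ C, 0 ≤ C ∧ ∀ n : ℕ, 0 < n → ∀ z ∈ polyDisc q \ ncDivisor q l, ∀ i j,
      ‖wirtD q i (logCut q m n) z‖ ≤ C * poincWeight q l i z ∧
      ‖wirtDbar q j (logCut q m n) z‖ ≤ C * poincWeight q l j z ∧
      ‖wirtD q i (wirtDbar q j (logCut q m n)) z‖ ≤
        C * (poincWeight q l i z * poincWeight q l j z) := by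
  obtain ⟨A, hA0, hA⟩ := exists_bound_of_vanishing contDiff_deriv_smoothDrop.continuous
    deriv_smoothDrop_eq_zero.1 deriv_smoothDrop_eq_zero.2
  obtain ⟨B, hB0, hB⟩ := exists_bound_of_vanishing
    ((contDiff_infty_iff_deriv).1 contDiff_deriv_smoothDrop).2.continuous
    deriv_deriv_smoothDrop_eq_zero.1 deriv_deriv_smoothDrop_eq_zero.2
  refine ⟨A + B, by positivity, fun n hn z hz i j => ?_⟩
  have hz0 : z m ≠ 0 := fun h => hz.2 ⟨m, hm, h⟩
  have hzm : 0 < ‖z m‖ := norm_pos_iff.2 hz0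
  have hw := one_le_poincWeight hz
  have hi0 : 0 ≤ poincWeight q l i z := zero_le_one.trans (hw i)
  have hj0 : 0 ≤ poincWeight q l j z := zero_le_one.trans (hw j)
  have hm0 : 0 ≤ poincWeight q l m z := zero_le_one.trans (hw m)
  have hn' : (0 : ℝ) < n := by exact_mod_cast hn
  have hkey : scaledLog n (z m) ≤ 2 → (n * ‖z m‖)⁻¹ ≤ poincWeight q l m z := by
    intro h
    rw [scaledLog_eq, div_le_iff₀ hn'] at h
    have hneg := Real.log_neg hzm (hz.1 m)
    rw [poincWeight_of_lt hm, one_div, abs_of_neg hneg]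
    have : 0 < -Real.log ‖z m‖ := by linarith
    refine inv_anti₀ (by positivity) ?_
    rw [mul_comm]
    gcongr
    linarith
  have h1 : |deriv smoothDrop (scaledLog n (z m))| * (n * ‖z m‖)⁻¹ ≤
      (A + B) * poincWeight q l m z := by
    rcases le_or_gt (scaledLog n (z m)) 2 with h | h
    · have := hkey h
      gcongr
      exact (hA _).trans (by linarith)
    · rw [deriv_smoothDrop_eq_zero.2 _ h]
      simp only [abs_zero, zero_mul]
      positivity
  have h2 : |deriv (deriv smoothDrop) (scaledLog n (z m))| *
      ((n * ‖z m‖)⁻¹ * (n * ‖z m‖)⁻¹) ≤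
      (A + B) * (poincWeight q l m z * poincWeight q l m z) := by
    rcases le_or_gt (scaledLog n (z m)) 2 with h | h
    · have := hkey h
      gcongr
      exact (hB _).trans (by linarith)
    · rw [deriv_deriv_smoothDrop_eq_zero.2 _ h]
      simp only [abs_zero, zero_mul]
      positivity
  refine ⟨?_, ?_, ?_⟩
  · rw [wirtD_logCut n hz0]
    split_ifs with hi
    · subst hi
      simpa using h1
    · simp only [norm_zero]
      positivity
  · rw [wirtDbar_logCut n hz0]
    split_ifs with hj
    · subst hj
      simpa [mul_comm] using h1
    · simp only [norm_zero]
      positivity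
  · rw [wirtD_wirtDbar_logCut n hz0]
    split_ifs with hij
    · obtain ⟨rfl, rfl⟩ := hij
      simpa using h2
    · simp only [norm_zero]
      positivity

end Domination

section Currents

variable {q l : ℕ}

lemma isOpen_polyDisc : IsOpen (polyDisc q) := by
  simp only [polyDisc, Set.ofPred_forall]
  exact isOpen_iInter_of_finite fun i => isOpen_lt (by fun_prop) continuous_const

lemma isClosed_ncDivisor : IsClosed (ncDivisor q l) := by
  have : ncDivisor q l = ⋃ i : Fin q, {z | (i : ℕ) < l ∧ z i = 0} := by
    ext z; simp [ncDivisor]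
  rw [this]
  refine isClosed_iUnion_of_finite fun i => ?_
  by_cases hi : (i : ℕ) < l
  · simp only [hi, true_and]
    exact isClosed_eq (by fun_prop) continuous_const
  · simp [hi]

lemma volume_ncDivisor : volume (ncDivisor q l) = 0 := by
  refine measure_mono_null (t := ⋃ i : Fin q, {z : Fin q → ℂ | z i = 0}) ?_ ?_
  · rintro z ⟨i, -, hi⟩
    exact Set.mem_iUnion.2 ⟨i, hi⟩
  · exact measure_iUnion_null fun i => Measure.pi_hyperplane (fun _ => volume) i 0

lemma polyDisc_diff_ae_eq :
    (polyDisc q \ ncDivisor q l : Set (Fin q → ℂ)) =ᵐ[volume] polyDisc q :=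
  sdiff_null_ae_eq_self volume_ncDivisor

lemma ContinuousOn.aestronglyMeasurable_polyDisc {f : (Fin q → ℂ) → ℂ}
    (hf : ContinuousOn f (polyDisc q \ ncDivisor q l)) :
    AEStronglyMeasurable f (volume.restrict (polyDisc q)) := by
  rw [← Measure.restrict_congr_set (polyDisc_diff_ae_eq (l := l))]
  exact hf.aestronglyMeasurable (isOpen_polyDisc.sdiff isClosed_ncDivisor).measurableSet

lemma ae_mem_polyDisc_diff :
    ∀ᵐ z ∂volume.restrict (polyDisc q), z ∈ polyDisc q \ ncDivisor q l := by
  rw [← Measure.restrict_congr_set (polyDisc_diff_ae_eq (l := l))]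
  exact ae_restrict_mem (isOpen_polyDisc.sdiff isClosed_ncDivisor).measurableSet

/-- A compact subset of the unit polydisc lies in a smaller closed polydisc. -/
lemma exists_radius_of_isCompact {K : Set (Fin q → ℂ)} (hK : IsCompact K) (hKU : K ⊆ polyDisc q) :
    ∃ r : ℝ, 0 < r ∧ r < 1 ∧ ∀ z ∈ K, ∀ k, ‖z k‖ ≤ r := by
  rcases K.eq_empty_or_nonempty with rfl | hne
  · exact ⟨1 / 2, by norm_num, by norm_num, by simp⟩
  · obtain ⟨x, hx, hmax⟩ := hK.exists_isMaxOn hne continuous_norm.continuousOn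
    have hx1 : ‖x‖ < 1 := (pi_norm_lt_iff one_pos).2 (hKU hx)
    exact ⟨max ‖x‖ (1 / 2), lt_max_of_lt_right (by norm_num), max_lt hx1 (by norm_num),
      fun z hz k => (norm_le_pi_norm z k).trans ((hmax hz).trans (le_max_left _ _))⟩

lemma wirt_eq_zero_of_notMem_tsupport {s : ℂ} {i : Fin q} {f : (Fin q → ℂ) → ℂ} {z : Fin q → ℂ}
    (hz : z ∉ tsupport f) : wirt q s i f z = 0 := by
  have h : f =ᶠ[nhds z] fun _ => 0 := notMem_tsupport_iff_eventuallyEq.1 hz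
  rw [h.wirt.eq_of_nhds, wirt_const]

lemma support_wirt_subset {s : ℂ} {i : Fin q} {f : (Fin q → ℂ) → ℂ} :
    Function.support (wirt q s i f) ⊆ tsupport f := fun z hz => by
  by_contra h
  exact hz (wirt_eq_zero_of_notMem_tsupport h)

lemma tsupport_wirt_subset {s : ℂ} {i : Fin q} {f : (Fin q → ℂ) → ℂ} :
    tsupport (wirt q s i f) ⊆ tsupport f :=
  closure_minimal support_wirt_subset (isClosed_tsupport f)

lemma HasCompactSupport.wirt {s : ℂ} {i : Fin q} {f : (Fin q → ℂ) → ℂ} (hf : HasCompactSupport f) :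
    HasCompactSupport (_root_.wirt q s i f) :=
  hf.mono' support_wirt_subset

lemma wirtD_wirtDbar_eq_zero_of_notMem_tsupport {i j : Fin q} {f : (Fin q → ℂ) → ℂ}
    {z : Fin q → ℂ} (hz : z ∉ tsupport f) : wirtD q i (wirtDbar q j f) z = 0 := by
  rw [wirtD_eq_wirt, wirtDbar_eq_wirt]
  exact wirt_eq_zero_of_notMem_tsupport fun h => hz (tsupport_wirt_subset h)

/-- The second derivatives of the truncated test functions are bounded by the Poincaré weights,
uniformly in the truncation. -/
lemma exists_truncation_bound {η : (Fin q → ℂ) → ℂ} (hη : ContDiff ℝ (⊤ : ℕ∞) η)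
    (hηc : HasCompactSupport η) (m : Fin q) (hm : (m : ℕ) < l) (i j : Fin q) :
    ∃ B, 0 ≤ B ∧ ∀ n : ℕ, 0 < n → ∀ z ∈ polyDisc q \ ncDivisor q l,
      ‖wirtD q i (wirtDbar q j (fun y => η y * logCut q m n y)) z‖ ≤
        B * (poincWeight q l i z * poincWeight q l j z) := by
  obtain ⟨C, hC0, hC⟩ := exists_logCut_bound q l m hm
  obtain ⟨A, hA⟩ := hη.continuous.bounded_above_of_compact_support hηc
  obtain ⟨A₁, hA₁⟩ := (hη.wirt (s := -Complex.I) (i := i)).continuous.bounded_above_of_compact_support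
    hηc.wirt
  obtain ⟨A₂, hA₂⟩ := (hη.wirt (s := Complex.I) (i := j)).continuous.bounded_above_of_compact_support
    hηc.wirt
  obtain ⟨A₃, hA₃⟩ := ((hη.wirt (s := Complex.I) (i := j)).wirt (s := -Complex.I)
    (i := i)).continuous.bounded_above_of_compact_support hηc.wirt.wirt
  have hA0 := (norm_nonneg _).trans (hA 0)
  have hA₁0 := (norm_nonneg _).trans (hA₁ 0)
  have hA₂0 := (norm_nonneg _).trans (hA₂ 0)
  have hA₃0 := (norm_nonneg _).trans (hA₃ 0)
  refine ⟨A * C + A₁ * C + (A₂ * C + A₃), by positivity, fun n hn z hz => ?_⟩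
  obtain ⟨h1, h2, h3⟩ := hC n hn z hz i j
  have hwi := one_le_poincWeight hz i
  have hwj := one_le_poincWeight hz j
  have hi : poincWeight q l i z ≤ poincWeight q l i z * poincWeight q l j z :=
    le_mul_of_one_le_right (by linarith) hwj
  have hj : poincWeight q l j z ≤ poincWeight q l i z * poincWeight q l j z :=
    le_mul_of_one_le_left (by linarith) hwi
  have hij : 1 ≤ poincWeight q l i z * poincWeight q l j z := hwi.trans hi
  set w := poincWeight q l i z * poincWeight q l j z
  rw [wirtD_wirtDbar_mul hη (contDiff_logCut hn)]
  rw [wirtD_eq_wirt, wirtDbar_eq_wirt] at *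
  have t1 : ‖η z * wirt q (-Complex.I) i (wirt q Complex.I j (logCut q m n)) z‖ ≤ A * (C * w) := by
    rw [norm_mul]; exact mul_le_mul (hA z) h3 (norm_nonneg _) hA0
  have t2 : ‖wirt q (-Complex.I) i η z * wirt q Complex.I j (logCut q m n) z‖ ≤ A₁ * (C * w) := by
    rw [norm_mul]
    exact mul_le_mul (hA₁ z) (h2.trans (by gcongr)) (norm_nonneg _) hA₁0
  have t3 : ‖wirt q Complex.I j η z * wirt q (-Complex.I) i (logCut q m n) z‖ ≤ A₂ * (C * w) := by
    rw [norm_mul]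
    exact mul_le_mul (hA₂ z) (h1.trans (by gcongr)) (norm_nonneg _) hA₂0
  have t4 : ‖wirt q (-Complex.I) i (wirt q Complex.I j η) z * logCut q m n z‖ ≤ A₃ * w := by
    rw [norm_mul]
    exact mul_le_mul (hA₃ z) ((norm_logCut_le n z).trans hij) (norm_nonneg _) hA₃0
  refine norm_add_le_of_le (norm_add_le_of_le t1 t2) (norm_add_le_of_le t3 t4) |>.trans ?_
  linarith

/-- A truncated test function is supported off one more component of the divisor. -/
lemma IsTestFn.mul_logCut {η : (Fin q → ℂ) → ℂ} {m : ℕ} (hmq : m < q)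
    (hη : IsTestFn q η (polyDisc q \ ncDivisor q m)) {n : ℕ} (hn : 0 < n) :
    IsTestFn q (fun y => η y * logCut q ⟨m, hmq⟩ n y) (polyDisc q \ ncDivisor q (m + 1)) := by
  obtain ⟨h1, h2, h3⟩ := hη
  refine ⟨h1.mul (contDiff_logCut hn), h2.mul_right, fun z hz => ?_⟩
  have hz' : z ∈ polyDisc q \ ncDivisor q m := h3 (tsupport_mul_subset_left hz)
  refine ⟨hz'.1, ?_⟩
  rintro ⟨i, hi, hzi⟩
  rcases (Nat.lt_succ_iff.1 hi).lt_or_eq with h | h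
  · exact hz'.2 ⟨i, h, hzi⟩
  · subst h
    have : z ∈ tsupport (logCut q i n) := tsupport_mul_subset_right hz
    exact notMem_tsupport_iff_eventuallyEq.2 (logCut_eventuallyEq_zero hn hzi) this

/-- The identity `∂∂̄[φ]/(2πi) = [T]` extends across one component of the divisor. -/
lemma extend_across_component (hl : 1 ≤ l) (hlq : l ≤ q) {φ : (Fin q → ℂ) → ℝ}
    (hcont : ContinuousOn φ (polyDisc q \ ncDivisor q l))
    (hφgrowth : ∃ C > 0, ∃ p : ℕ, ∀ z ∈ polyDisc q \ ncDivisor q l,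
      |φ z| ≤ C * (logLogFactor q l z) ^ p + C)
    {T : (Fin q → ℂ) → Matrix (Fin q) (Fin q) ℂ}
    (hTcont : ∀ i j, ContinuousOn (fun z => T z i j) (polyDisc q \ ncDivisor q l))
    (hTgrowth : MatLogLogGrowth q l T (polyDisc q)) (c : ℂ) {m : ℕ} (hml : m < l) (i j : Fin q)
    (hrep : ∀ η, IsTestFn q η (polyDisc q \ ncDivisor q (m + 1)) →
      c * (∫ z in polyDisc q, (φ z : ℂ) * wirtD q i (wirtDbar q j η) z)
        = ∫ z in polyDisc q, T z i j * η z)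
    {η : (Fin q → ℂ) → ℂ} (hη : IsTestFn q η (polyDisc q \ ncDivisor q m)) :
    c * (∫ z in polyDisc q, (φ z : ℂ) * wirtD q i (wirtDbar q j η) z)
      = ∫ z in polyDisc q, T z i j * η z := by
  have hmq : m < q := hml.trans_le hlq
  let k : Fin q := ⟨m, hmq⟩
  have hkl : (k : ℕ) < l := hml
  obtain ⟨hη1, hη2, hη3⟩ := id hη
  obtain ⟨r, hr0, hr1, hr⟩ := exists_radius_of_isCompact hη2 (hη3.trans Set.sdiff_subset)
  have hpow : ∀ (x : ℝ) (p : ℕ), x ^ p ≤ |x| ^ p := fun x p => by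
    rw [← abs_pow]; exact le_abs_self _
  have hsupp : ∀ n, tsupport (fun y => η y * logCut q k n y) ⊆ tsupport η := fun n =>
    tsupport_mul_subset_left
  have hlim : ∀ z ∈ polyDisc q \ ncDivisor q l, ∀ᶠ n : ℕ in Filter.atTop,
      (fun y => η y * logCut q k (n + 1) y) =ᶠ[nhds z] η := by
    intro z hz
    have hzk : z k ≠ 0 := fun h => hz.2 ⟨k, hkl, h⟩
    filter_upwards [(Filter.tendsto_add_atTop_nat 1).eventually (logCut_eventuallyEq_one hzk)]
      with n hn
    filter_upwards [hn] with y hy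
    rw [hy, mul_one]
  have hcontD : ∀ {f : (Fin q → ℂ) → ℂ}, ContDiff ℝ (⊤ : ℕ∞) f →
      Continuous (wirtD q i (wirtDbar q j f)) := fun hf => by
    rw [wirtD_eq_wirt, wirtDbar_eq_wirt]
    exact hf.wirt.wirt.continuous
  have lim1 : Filter.Tendsto (fun n : ℕ => ∫ z in polyDisc q,
      (φ z : ℂ) * wirtD q i (wirtDbar q j (fun y => η y * logCut q k (n + 1) y)) z) Filter.atTop
      (nhds (∫ z in polyDisc q, (φ z : ℂ) * wirtD q i (wirtDbar q j η) z)) := by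
    obtain ⟨C, hC0, p, hC⟩ := hφgrowth
    obtain ⟨F, hF, hF0, hFb⟩ := exists_integrable_dominating hl hr0 hr1 p
    obtain ⟨B, hB0, hB⟩ := exists_truncation_bound hη1 hη2 k hkl i j
    refine tendsto_integral_of_dominated_convergence (fun z => C * B * F z) (fun n => ?_)
      (hF.restrict.const_mul _) (fun n => ?_) ?_
    · exact (Complex.continuous_ofReal.comp_continuousOn hcont).aestronglyMeasurable_polyDisc.mul
        (hcontD (hη1.mul (contDiff_logCut n.succ_pos))).aestronglyMeasurable
    · filter_upwards [ae_mem_polyDisc_diff (l := l)] with z hz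
      by_cases hzs : z ∈ tsupport η
      · have hwi := one_le_poincWeight hz i
        have hwj := one_le_poincWeight hz j
        have h1 : ‖(φ z : ℂ)‖ ≤ C * (|logLogFactor q l z| ^ p + 1) := by
          rw [Complex.norm_real, Real.norm_eq_abs, mul_add, mul_one]
          exact (hC z hz).trans
            (by linarith [mul_le_mul_of_nonneg_left (hpow (logLogFactor q l z) p) hC0.le])
        rw [norm_mul]
        calc _ ≤ C * (|logLogFactor q l z| ^ p + 1) *
              (B * (poincWeight q l i z * poincWeight q l j z)) :=
              mul_le_mul h1 (hB _ n.succ_pos z hz) (norm_nonneg _) (by positivity)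
          _ = C * B * (poincWeight q l i z * poincWeight q l j z *
              (|logLogFactor q l z| ^ p + 1)) := by ring
          _ ≤ C * B * F z := by
              gcongr
              exact hFb z hz (hr z hzs) i j
      · rw [wirtD_wirtDbar_eq_zero_of_notMem_tsupport fun h => hzs (hsupp _ h), mul_zero, norm_zero]
        have := hF0 z
        positivity
    · filter_upwards [ae_mem_polyDisc_diff (l := l)] with z hz
      refine tendsto_const_nhds.congr' ?_
      filter_upwards [hlim z hz] with n hn
      rw [wirtD_eq_wirt, wirtDbar_eq_wirt, hn.wirt.wirt.eq_of_nhds]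
  have lim2 : Filter.Tendsto (fun n : ℕ => ∫ z in polyDisc q,
      T z i j * (η z * logCut q k (n + 1) z)) Filter.atTop
      (nhds (∫ z in polyDisc q, T z i j * η z)) := by
    obtain ⟨C, hC0, p, hC⟩ := hTgrowth
    obtain ⟨F, hF, hF0, hFb⟩ := exists_integrable_dominating hl hr0 hr1 p
    obtain ⟨A, hA⟩ := hη1.continuous.bounded_above_of_compact_support hη2
    have hA0 := (norm_nonneg _).trans (hA 0)
    refine tendsto_integral_of_dominated_convergence (fun z => C * A * F z) (fun n => ?_)
      (hF.restrict.const_mul _) (fun n => ?_) ?_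
    · exact (hTcont i j).aestronglyMeasurable_polyDisc.mul
        (hη1.mul (contDiff_logCut n.succ_pos)).continuous.aestronglyMeasurable
    · filter_upwards [ae_mem_polyDisc_diff (l := l), ae_restrict_of_ae hC] with z hz hCz
      by_cases hzs : z ∈ tsupport η
      · have hwi := one_le_poincWeight hz i
        have hwj := one_le_poincWeight hz j
        have h1 : ‖T z i j‖ ≤ C * poincWeight q l i z * poincWeight q l j z *
            (|logLogFactor q l z| ^ p + 1) := by
          exact (hCz hz i j).trans (mul_le_mul_of_nonneg_left
            (by linarith [hpow (logLogFactor q l z) p]) (by positivity))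
        have h2 : ‖η z * logCut q k (n + 1) z‖ ≤ A := by
          rw [norm_mul, ← mul_one A]
          exact mul_le_mul (hA z) (norm_logCut_le _ z) (norm_nonneg _) hA0
        rw [norm_mul]
        calc _ ≤ C * poincWeight q l i z * poincWeight q l j z *
              (|logLogFactor q l z| ^ p + 1) * A :=
              mul_le_mul h1 h2 (norm_nonneg _) (by positivity)
          _ = C * A * (poincWeight q l i z * poincWeight q l j z *
              (|logLogFactor q l z| ^ p + 1)) := by ring
          _ ≤ C * A * F z := by
              gcongr
              exact hFb z hz (hr z hzs) i j
      · rw [image_eq_zero_of_notMem_tsupport hzs, zero_mul, mul_zero, norm_zero]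
        have := hF0 z
        positivity
    · filter_upwards [ae_mem_polyDisc_diff (l := l)] with z hz
      refine tendsto_const_nhds.congr' ?_
      filter_upwards [hlim z hz] with n hn
      rw [hn.eq_of_nhds]
  refine tendsto_nhds_unique (lim1.const_mul c) (lim2.congr fun n => ?_)
  exact (hrep _ (hη.mul_logCut hmq n.succ_pos)).symm

end Currents

/-- Let `φ` be continuous with log-log growth along the normal crossing divisor
`D = ∪_{i<l}{z_i=0}` on the unit polydisc `U ⊂ ℂ^q`, and suppose the current
`T = ∂∂̄[φ]/(2πi)` on `U \ D` has log-log growth along `D`. Then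
`∂∂̄[φ]_{L¹}/(2πi) = [T]_{L¹}` as currents on all of `U`: the trivial `L¹`-extension of
the potential computes the trivial `L¹`-extension of the curvature, with no residual
current supported on `D`. -/
theorem stmt12 (q l : ℕ) (hl : 1 ≤ l) (hlq : l ≤ q)
    (φ : (Fin q → ℂ) → ℝ)
    (hcont : ContinuousOn φ (polyDisc q \ ncDivisor q l))
    (hφgrowth : ∃ C > 0, ∃ p : ℕ, ∀ z ∈ polyDisc q \ ncDivisor q l,
      |φ z| ≤ C * (logLogFactor q l z) ^ p + C)
    (T : (Fin q → ℂ) → Matrix (Fin q) (Fin q) ℂ)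
    (hTrep : ∀ η, IsTestFn q η (polyDisc q \ ncDivisor q l) → ∀ i j,
      (1 / (2 * Real.pi * Complex.I)) *
          (∫ z in polyDisc q \ ncDivisor q l, (φ z : ℂ) * wirtD q i (wirtDbar q j η) z)
        = ∫ z in polyDisc q \ ncDivisor q l, T z i j * η z)
    (hTcont : ∀ i j, ContinuousOn (fun z => T z i j) (polyDisc q \ ncDivisor q l))
    (hTgrowth : MatLogLogGrowth q l T (polyDisc q)) :
    ∀ η, IsTestFn q η (polyDisc q) → ∀ i j,
      (1 / (2 * Real.pi * Complex.I)) *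
          (∫ z in polyDisc q, (φ z : ℂ) * wirtD q i (wirtDbar q j η) z)
        = ∫ z in polyDisc q, T z i j * η z := by
  intro η hη i j
  have key : ∀ d m, m + d = l → ∀ η, IsTestFn q η (polyDisc q \ ncDivisor q m) →
      (1 / (2 * Real.pi * Complex.I)) *
          (∫ z in polyDisc q, (φ z : ℂ) * wirtD q i (wirtDbar q j η) z)
        = ∫ z in polyDisc q, T z i j * η z := by
    intro d
    induction d with
    | zero =>
      rintro m rfl η hη
      have h := hTrep η hη i j
      rwa [setIntegral_congr_set polyDisc_diff_ae_eq, setIntegral_congr_set polyDisc_diff_ae_eq]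
        at h
    | succ d ih =>
      intro m hmd η hη
      exact extend_across_component hl hlq hcont hφgrowth hTcont hTgrowth _ (by omega) i j
        (ih (m + 1) (by omega)) hη
  refine key l 0 (by omega) η ⟨hη.1, hη.2.1, fun z hz => ⟨hη.2.2 hz, ?_⟩⟩
  rintro ⟨k, hk, -⟩
  exact absurd hk (Nat.not_lt_zero _)
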